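/- arXiv:1405.3078 — 4 statements merged into one kernel-verified Lean document; each statement's English description precedes it below -/
import Mathlib

section
/- (Jacobson–Morosov for gl(V)) For any nonzero nilpotent endomorphism N of a finite-dimensional vector space V over a field of characteristic zero, there exist endomorphisms M and Y such that [Y,M] = 2M, [Y,N] = -2N, and [M,N] = Y. -/
open Polynomial in
/-- An `sl₂`-type partner for multiplication by `X` on a `k[X]`-module. -/
def JMPartner (k : Type*) [Field k] (A : Type*) [AddCommGroup A] [Module k[X] A] [Module k A]
    (M : A →ₗ[k] A) : Prop :=
  (∀ a : A, (M ((X : k[X]) • M a) - (X : k[X]) • M (M a)) - (M (M ((X : k[X]) • a))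
      - M ((X : k[X]) • M a)) = (2 : k) • M a) ∧
  (∀ a : A, (M ((X : k[X]) • (X : k[X]) • a) - (X : k[X]) • M ((X : k[X]) • a))
      - ((X : k[X]) • M ((X : k[X]) • a) - (X : k[X]) • (X : k[X]) • M a)
      = -((2 : k) • (X : k[X]) • a))

open Polynomial in
/-- The differential operator `f ↦ (n f - X f')'`. -/
noncomputable def jmOp (k : Type*) [Field k] (n : ℕ) : k[X] →ₗ[k] k[X] :=
  derivative ∘ₗ ((n : k) • LinearMap.id - (LinearMap.mulLeft k (X : k[X])) ∘ₗ derivative)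

open Polynomial in
theorem jmOp_apply (k : Type*) [Field k] (n : ℕ) (f : k[X]) :
    jmOp k n f = derivative ((n : k[X]) * f - X * derivative f) := by
  simp [jmOp, smul_eq_C_mul]

open Polynomial in
theorem jmOp_partner (k : Type*) [Field k] (n : ℕ) : JMPartner k k[X] (jmOp k n) := by
  constructor <;> intro a <;>
  simp only [jmOp_apply, smul_eq_mul, smul_eq_C_mul, derivative_mul, derivative_sub,
    derivative_add, derivative_X, derivative_natCast, map_ofNat, derivative_one, derivative_zero] <;>
  ring

open Polynomial in
theorem jmOp_mem (k : Type*) [Field k] (n : ℕ) (f : k[X])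
    (hf : f ∈ Submodule.span k[X] {(X : k[X]) ^ n}) :
    jmOp k n f ∈ Submodule.span k[X] {(X : k[X]) ^ n} := by
  obtain ⟨g, rfl⟩ := Submodule.mem_span_singleton.1 hf
  refine Submodule.mem_span_singleton.2 ⟨-(((n : k[X]) + 1) * derivative g + X * derivative (derivative g)), ?_⟩
  have h : (n : k[X]) * (g • X ^ n) - X * derivative (g • X ^ n) = -(X ^ (n + 1) * derivative g) := by
    rcases n with _ | n
    · simp
    · simp only [smul_eq_mul, derivative_mul, derivative_X_pow, Nat.add_sub_cancel, map_natCast]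
      ring
  rw [jmOp_apply, h]
  simp only [smul_eq_mul, derivative_mul, derivative_X_pow, Nat.add_sub_cancel, map_natCast,
    derivative_neg]
  push_cast
  ring

open Polynomial in
theorem jm_quot (k : Type*) [Field k] (n : ℕ) :
    ∃ M, JMPartner k (k[X] ⧸ Submodule.span k[X] {(X : k[X]) ^ n}) M := by
  let S := Submodule.span k[X] {(X : k[X]) ^ n}
  let e := Submodule.Quotient.restrictScalarsEquiv k S
  let M₀ := (S.restrictScalars k).mapQ (S.restrictScalars k) (jmOp k n) (fun f hf => jmOp_mem k n f hf)
  let M : (k[X] ⧸ S) →ₗ[k] (k[X] ⧸ S) := e.toLinearMap ∘ₗ M₀ ∘ₗ e.symm.toLinearMap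
  have hM : ∀ f : k[X], M (Submodule.Quotient.mk f) = Submodule.Quotient.mk (jmOp k n f) :=
    fun f => rfl
  refine ⟨M, ?_, ?_⟩
  · intro a
    obtain ⟨f, rfl⟩ := Submodule.Quotient.mk_surjective _ a
    have := congrArg (Submodule.Quotient.mk (p := S)) ((jmOp_partner k n).1 f)
    simpa only [hM, ← Submodule.Quotient.mk_smul, ← Submodule.Quotient.mk_sub] using this
  · intro a
    obtain ⟨f, rfl⟩ := Submodule.Quotient.mk_surjective _ a
    have := congrArg (Submodule.Quotient.mk (p := S)) ((jmOp_partner k n).2 f)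
    simpa only [hM, ← Submodule.Quotient.mk_smul, ← Submodule.Quotient.mk_sub,
      ← Submodule.Quotient.mk_neg] using this

open Polynomial DirectSum in
theorem jm_sum (k : Type*) [Field k] {ι : Type*} (A : ι → Type*)
    [∀ i, AddCommGroup (A i)] [∀ i, Module k[X] (A i)] [∀ i, Module k (A i)]
    (h : ∀ i, ∃ M, JMPartner k (A i) M) : ∃ M, JMPartner k (⨁ i, A i) M := by
  choose M hM using h
  have key : ∀ (a : ⨁ i, A i) i, DFinsupp.mapRange.linearMap M a i = M i (a i) := fun a i => rfl
  refine ⟨DFinsupp.mapRange.linearMap M, ?_, ?_⟩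
  · intro a
    refine DFinsupp.ext fun i => ?_
    exact (hM i).1 (a i)
  · intro a
    refine DFinsupp.ext fun i => ?_
    exact (hM i).2 (a i)

/-- **Jacobson–Morosov for `gl(V)`.**
For any nonzero nilpotent endomorphism `N` of a finite-dimensional vector space `V` over a
field of characteristic zero there exist endomorphisms `M` and `Y` such that
`[Y,M] = 2M`, `[Y,N] = -2N` and `[M,N] = Y`. -/
theorem jacobson_morosov_gl
    (k : Type*) [Field k] [CharZero k]
    (V : Type*) [AddCommGroup V] [Module k V] [FiniteDimensional k V]
    (N : Module.End k V) (hN : N ≠ 0) (hnil : IsNilpotent N) :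
    ∃ M Y : Module.End k V,
      ⁅Y, M⁆ = (2 : k) • M ∧ ⁅Y, N⁆ = -((2 : k) • N) ∧ ⁅M, N⁆ = Y := by
  classical
  obtain ⟨r, hr⟩ := hnil
  have htor : Module.IsTorsion' (Module.AEval' N) (Submonoid.powers (Polynomial.X : Polynomial k)) := by
    intro x
    refine ⟨⟨Polynomial.X ^ r, r, rfl⟩, ?_⟩
    obtain ⟨v, rfl⟩ := (Module.AEval'.of N).surjective x
    change (Polynomial.X ^ r : Polynomial k) • (Module.AEval'.of N v) = 0
    rw [Module.AEval'.X_pow_smul_of, hr]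
    simp
  obtain ⟨d, e, ⟨E⟩⟩ := Module.torsion_by_prime_power_decomposition Polynomial.irreducible_X htor
  obtain ⟨M, h1, h2⟩ := jm_sum k _ (fun i => jm_quot k (e i))
  let L := (Module.AEval'.of N).trans (E.restrictScalars k)
  have hL : ∀ v, L (N v) = (Polynomial.X : Polynomial k) • L v := by
    intro v
    change E (Module.AEval'.of N (N v)) = (Polynomial.X : Polynomial k) • E (Module.AEval'.of N v)
    rw [← map_smul, Module.AEval'.X_smul_of]
  let M' : Module.End k V := L.symm.toLinearMap ∘ₗ M ∘ₗ L.toLinearMap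
  have hM : ∀ v, L (M' v) = M (L v) := fun v => by simp [M']
  refine ⟨M', ⁅M', N⁆, ?_, ?_, rfl⟩
  · ext v
    apply L.injective
    simp only [Ring.lie_def, LinearMap.sub_apply, Module.End.mul_apply, LinearMap.smul_apply,
      map_sub, map_smul, hM, hL]
    exact h1 (L v)
  · ext v
    apply L.injective
    simp only [Ring.lie_def, LinearMap.sub_apply, Module.End.mul_apply, LinearMap.smul_apply,
      LinearMap.neg_apply, map_neg, map_sub, map_smul, hM, hL]
    exact h2 (L v)
end

section
/- Let N be a nilpotent endomorphism of a finite-dimensional vector space V with weight filtration W_•(N) centered at k. Define Gr_{k+ℓ}W_prim as the kernel of the map induced by N^{ℓ+1} from Gr_{k+ℓ}W to Gr_{k-ℓ-2}W. Then for ℓ ≥ 0, Gr_{k+ℓ}W decomposes as the direct sum over a ≥ 0 of the images of N^a applied to Gr_{k+ℓ+2a}W_prim (Lefschetz primitive decomposition): Gr_{k+ℓ}W = ⊕_{a≥0} N^a(Gr_{k+ℓ+2a}W_prim). -/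
/-- `W : ℤ → Submodule K V` is the weight filtration of the nilpotent endomorphism `N`
(with `N ^ (k+1) = 0`) centered at `k`: increasing, `W ℓ = 0` for `ℓ < 0`, `W ℓ = V` for
`ℓ ≥ 2k`, `N (W ℓ) ⊆ W (ℓ-2)`, and `N ^ ℓ` induces an isomorphism
`Gr_{k+ℓ} W ≃ Gr_{k-ℓ} W` for `0 ≤ ℓ ≤ k` (expressed elementwise modulo the lower steps). -/
def IsWeightFiltration (K V : Type*) [Field K] [AddCommGroup V] [Module K V]
    (k : ℕ) (N : Module.End K V) (W : ℤ → Submodule K V) : Prop :=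
  Monotone W ∧
  (∀ ℓ : ℤ, ℓ < 0 → W ℓ = ⊥) ∧
  (∀ ℓ : ℤ, 2 * (k : ℤ) ≤ ℓ → W ℓ = ⊤) ∧
  (∀ ℓ : ℤ, (W ℓ).map N ≤ W (ℓ - 2)) ∧
  (∀ ℓ : ℕ, ℓ ≤ k →
    (∀ v ∈ W ((k : ℤ) - ℓ), ∃ u ∈ W ((k : ℤ) + ℓ),
        v - (N ^ ℓ) u ∈ W ((k : ℤ) - ℓ - 1)) ∧
    (∀ u ∈ W ((k : ℤ) + ℓ), (N ^ ℓ) u ∈ W ((k : ℤ) - ℓ - 1) → u ∈ W ((k : ℤ) + ℓ - 1)))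

/-- The subspace of `W (k+m)` consisting of vectors whose class in
`Gr_{k+m} W = W_{k+m}/W_{k+m-1}` is primitive, i.e. is killed by the graded map
`N^{m+1} : Gr_{k+m} W → Gr_{k-m-2} W`.  (The primitive subspace
`Gr_{k+m} W_prim` is the image of this subspace in the quotient `Gr_{k+m} W`.) -/
def primLift (K V : Type*) [Field K] [AddCommGroup V] [Module K V]
    (k : ℕ) (N : Module.End K V) (W : ℤ → Submodule K V) (m : ℕ) : Submodule K V :=
  W ((k : ℤ) + m) ⊓ Submodule.comap ((N ^ (m + 1) : Module.End K V) : V →ₗ[K] V)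
    (W ((k : ℤ) - m - 3))

section helpers

variable {K V : Type*} [Field K] [AddCommGroup V] [Module K V]
  {k : ℕ} {N : Module.End K V} {W : ℤ → Submodule K V}

theorem wf_pow_mem (hW : IsWeightFiltration K V k N W) (a : ℕ) :
    ∀ (i j : ℤ) (x : V), x ∈ W i → i - 2 * a ≤ j → (N ^ a) x ∈ W j := by
  induction a with
  | zero =>
    intro i j x hx hij
    simpa using hW.1 (by simpa using hij) hx
  | succ a ih =>
    intro i j x hx hij
    rw [pow_succ, Module.End.mul_apply]
    refine ih (i - 2) j (N x) (hW.2.2.2.1 i (Submodule.mem_map_of_mem hx)) ?_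
    push_cast at hij
    linarith

theorem prim_map_mem (hW : IsWeightFiltration K V k N W) (ℓ b : ℕ) (x : V)
    (hx : x ∈ primLift K V k N W (ℓ + 2 * b)) : (N ^ b) x ∈ W ((k : ℤ) + ℓ) :=
  wf_pow_mem hW b _ _ x hx.1 (by push_cast; linarith)

theorem prim_span (hW : IsWeightFiltration K V k N W) :
    ∀ (d ℓ : ℕ), k < ℓ + d → ∀ x ∈ W ((k : ℤ) + ℓ),
      x ∈ W ((k : ℤ) + ℓ - 1) ⊔ ⨆ a : ℕ,
        Submodule.map ((N ^ a : Module.End K V) : V →ₗ[K] V)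
          (primLift K V k N W (ℓ + 2 * a)) := by
  intro d
  induction d with
  | zero =>
    intro ℓ h x _
    refine Submodule.mem_sup_left ?_
    rw [hW.2.2.1 _ (by omega)]
    trivial
  | succ d ih =>
    intro ℓ h x hx
    have hNx : (N ^ (ℓ + 1)) x ∈ W ((k : ℤ) - ℓ - 2) :=
      wf_pow_mem hW (ℓ + 1) _ _ x hx (by push_cast; linarith)
    have hprim : ∀ y, y ∈ primLift K V k N W ℓ → y ∈ W ((k : ℤ) + ℓ - 1) ⊔ ⨆ a : ℕ,
        Submodule.map ((N ^ a : Module.End K V) : V →ₗ[K] V)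
          (primLift K V k N W (ℓ + 2 * a)) := by
      intro y hy
      refine Submodule.mem_sup_right (Submodule.mem_iSup_of_mem 0 ⟨y, hy, ?_⟩)
      simp
    by_cases hk : ℓ + 2 ≤ k
    · obtain ⟨u, hu, hu'⟩ := (hW.2.2.2.2 (ℓ + 2) hk).1 ((N ^ (ℓ + 1)) x)
        (hW.1 (by push_cast; linarith) hNx)
      have h1 := ih (ℓ + 2) (by omega) u hu
      have hNu : N u ∈ W ((k : ℤ) + ℓ) := by
        simpa using wf_pow_mem hW 1 _ ((k : ℤ) + ℓ) u hu (by push_cast; linarith)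
      have h2 : x - N u ∈ primLift K V k N W ℓ := by
        refine ⟨Submodule.sub_mem _ hx hNu, ?_⟩
        rw [SetLike.mem_coe, Submodule.mem_comap, map_sub, ← Module.End.mul_apply, ← pow_succ]
        exact hW.1 (by push_cast; linarith) hu'
      have h3 : N u ∈ W ((k : ℤ) + ℓ - 1) ⊔ ⨆ a : ℕ,
          Submodule.map ((N ^ a : Module.End K V) : V →ₗ[K] V)
            (primLift K V k N W (ℓ + 2 * a)) := by
        have h4 := Submodule.mem_map_of_mem (f := N) h1
        rw [Submodule.map_sup, Submodule.map_iSup] at h4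
        revert h4
        suffices hle : _ from fun h4 => SetLike.le_def.1 hle h4
        refine sup_le_sup ?_ ?_
        · rintro _ ⟨w, hw, rfl⟩
          simpa using wf_pow_mem hW 1 _ ((k : ℤ) + ℓ - 1) w hw (by push_cast; linarith)
        · refine iSup_le fun a => le_trans ?_ (le_iSup _ (a + 1))
          rintro _ ⟨_, ⟨w, hw, rfl⟩, rfl⟩
          refine ⟨w, ?_, ?_⟩
          · rwa [show ℓ + 2 * (a + 1) = ℓ + 2 + 2 * a by ring]
          · rw [pow_succ', Module.End.mul_apply]
      have h5 := Submodule.add_mem _ (hprim _ h2) h3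
      rwa [sub_add_cancel] at h5
    · refine hprim x ⟨hx, ?_⟩
      rw [hW.2.1 _ (by omega), Submodule.mem_bot] at hNx
      rw [SetLike.mem_coe, Submodule.mem_comap, hNx]
      exact Submodule.zero_mem _

theorem prim_indep (hW : IsWeightFiltration K V k N W) :
    ∀ (n ℓ : ℕ) (p : ℕ → V), (∀ b, p b ∈ primLift K V k N W (ℓ + 2 * b)) →
      (∑ b ∈ Finset.range n, (N ^ b) (p b)) ∈ W ((k : ℤ) + ℓ - 1) →
      ∀ b < n, (N ^ b) (p b) ∈ W ((k : ℤ) + ℓ - 1) := by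
  intro n
  induction n with
  | zero => intro ℓ p _ _ b hb; omega
  | succ n ih =>
    intro ℓ p hp hs
    have hp' : ∀ b, p (b + 1) ∈ primLift K V k N W (ℓ + 2 + 2 * b) := by
      intro b
      have := hp (b + 1)
      rwa [show ℓ + 2 * (b + 1) = ℓ + 2 + 2 * b by ring] at this
    set s := ∑ b ∈ Finset.range n, (N ^ b) (p (b + 1)) with hsdef
    have hsum : ∑ b ∈ Finset.range (n + 1), (N ^ b) (p b) = N s + p 0 := by
      rw [Finset.sum_range_succ', hsdef, map_sum]
      simp [pow_succ']
    rw [hsum] at hs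
    have hsW : s ∈ W ((k : ℤ) + (ℓ + 2 : ℕ)) :=
      Submodule.sum_mem _ fun b _ => prim_map_mem hW (ℓ + 2) b _ (hp' b)
    have hp0 : (N ^ (ℓ + 1)) (p 0) ∈ W ((k : ℤ) - ℓ - 3) := (hp 0).2
    have hs1 : s ∈ W ((k : ℤ) + (ℓ + 2 : ℕ) - 1) := by
      by_cases hk : ℓ + 2 ≤ k
      · refine (hW.2.2.2.2 (ℓ + 2) hk).2 s hsW ?_
        have h1 : (N ^ (ℓ + 1)) (N s + p 0) ∈ W ((k : ℤ) - ℓ - 3) :=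
          wf_pow_mem hW (ℓ + 1) _ _ _ hs (by push_cast; linarith)
        have h2 := Submodule.sub_mem _ h1 hp0
        rw [map_add, add_sub_cancel_right, ← Module.End.mul_apply, ← pow_succ] at h2
        exact hW.1 (by push_cast; linarith) h2
      · rw [hW.2.2.1 _ (by push_cast; omega)]
        trivial
    have hN : ∀ x ∈ W ((k : ℤ) + (ℓ + 2 : ℕ) - 1), N x ∈ W ((k : ℤ) + ℓ - 1) := by
      intro x hx
      simpa using wf_pow_mem hW 1 _ ((k : ℤ) + ℓ - 1) x hx (by push_cast; linarith)
    intro b hb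
    cases b with
    | zero =>
      have := Submodule.sub_mem _ hs (hN s hs1)
      simpa using this
    | succ b =>
      have := hN _ (ih (ℓ + 2) (fun b => p (b + 1)) hp' hs1 b (by omega))
      rwa [← Module.End.mul_apply, ← pow_succ'] at this

end helpers

/-- **Lefschetz primitive decomposition of the graded pieces.**
Let `N` be nilpotent with `N^{k+1} = 0` and weight filtration `W` centered at `k`.  For
`ℓ ≥ 0`, `Gr_{k+ℓ} W = ⊕_{a ≥ 0} N^a (Gr_{k+ℓ+2a} W_prim)`: working with lifts modulo
`W (k+ℓ-1)`, the subspaces `N^a (primLift (ℓ+2a))` together with `W (k+ℓ-1)` span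
`W (k+ℓ)`, and their images in the quotient `Gr_{k+ℓ} W` are independent. -/
theorem graded_primitive_decomposition
    (K : Type*) [Field K] [CharZero K]
    (V : Type*) [AddCommGroup V] [Module K V] [FiniteDimensional K V]
    (k : ℕ) (N : Module.End K V) (hnil : N ^ (k + 1) = 0)
    (W : ℤ → Submodule K V) (hW : IsWeightFiltration K V k N W) (ℓ : ℕ) :
    (W ((k : ℤ) + ℓ - 1) ⊔ ⨆ a : ℕ,
        Submodule.map ((N ^ a : Module.End K V) : V →ₗ[K] V)
          (primLift K V k N W (ℓ + 2 * a)) = W ((k : ℤ) + ℓ)) ∧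
    (∀ a : ℕ,
      (Submodule.map ((N ^ a : Module.End K V) : V →ₗ[K] V)
          (primLift K V k N W (ℓ + 2 * a)) ⊔ W ((k : ℤ) + ℓ - 1)) ⊓
        ((⨆ b : ℕ, ⨆ _ : b ≠ a,
          Submodule.map ((N ^ b : Module.End K V) : V →ₗ[K] V)
            (primLift K V k N W (ℓ + 2 * b))) ⊔ W ((k : ℤ) + ℓ - 1)) ≤
        W ((k : ℤ) + ℓ - 1)) := by
  refine ⟨le_antisymm (sup_le (hW.1 (by linarith)) (iSup_le fun a => ?_))
    (fun x hx => prim_span hW (k + 1) ℓ (by omega) x hx), fun a => ?_⟩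
  · rintro _ ⟨x, hx, rfl⟩
    exact prim_map_mem hW ℓ a x hx
  · rintro x ⟨h1, h2⟩
    obtain ⟨_, ⟨p, hp, rfl⟩, w, hw, rfl⟩ := Submodule.mem_sup.1 h1
    obtain ⟨y, hy, w', hw', hyw⟩ := Submodule.mem_sup.1 h2
    obtain ⟨f, hf, rfl⟩ := (Submodule.mem_iSup_iff_exists_finsupp _ _).1 hy
    have hq : ∀ b, ∃ q ∈ primLift K V k N W (ℓ + 2 * b), (N ^ b) q = f b ∧ (b = a → q = 0) := by
      intro b
      have hb := hf b
      by_cases hba : b = a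
      · simp [hba] at hb
        exact ⟨0, Submodule.zero_mem _, by simp [hba, hb], fun _ => rfl⟩
      · simp only [ne_eq, hba, not_false_eq_true, iSup_pos] at hb
        obtain ⟨q, hq, hq'⟩ := hb
        exact ⟨q, hq, hq', fun h => absurd h hba⟩
    choose q hqP hqf hqa using hq
    set n := max (a + 1) (f.support.sup id + 1) with hn
    have hsub : f.support ⊆ Finset.range n := by
      intro b hb
      have : b ≤ f.support.sup id := Finset.le_sup (f := id) hb
      rw [Finset.mem_range]
      omega
    have han : a ∈ Finset.range n := by
      rw [Finset.mem_range]
      omega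
    rw [Finsupp.sum_of_support_subset f hsub _ (fun _ _ => rfl)] at hyw
    have key := prim_indep hW n ℓ (fun b => (if b = a then p else 0) - q b)
      (fun b => by
        refine Submodule.sub_mem _ ?_ (hqP b)
        split_ifs with h
        · rw [h]; exact hp
        · exact Submodule.zero_mem _)
      (by
        have e : ∑ b ∈ Finset.range n, (N ^ b) ((if b = a then p else 0) - q b)
            = w' - w := by
          have e1 : ∑ b ∈ Finset.range n, (N ^ b) (if b = a then p else 0) = (N ^ a) p := by
            rw [Finset.sum_eq_single_of_mem a han]
            · simp
            · intro b _ hb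
              simp [hb]
          simp only [map_sub, Finset.sum_sub_distrib, e1, hqf]
          rw [sub_eq_sub_iff_add_eq_add, ← hyw, add_comm]
        rw [e]
        exact Submodule.sub_mem _ hw' hw) a (Finset.mem_range.1 han)
    simp only [if_true, hqa a rfl, sub_zero] at key
    exact Submodule.add_mem _ key hw
end

section
/- Let N be a nilpotent endomorphism of a finite-dimensional vector space V with N^{k+1} = 0 and weight filtration W_•(N) centered at k. Then W_ℓ(N) = ⊕_{m - 2a ≤ ℓ - k} N^a P(m), where V = ⊕_m ⊕_{a=0}^{m} N^a P(m) is the decomposition coming from any standard triple {M,Y,N} with P(m) the highest weight space of the isotypic component V(m). -/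
set_option linter.unusedSectionVars false
set_option linter.unusedSimpArgs false

namespace SlTwoAux

variable {K : Type*} [Field K] [CharZero K]
    {V : Type*} [AddCommGroup V] [Module K V]

/-- The span of the string pieces of weight at most `c`. -/
def strS (M Y N : Module.End K V) (c : ℤ) : Submodule K V :=
  ⨆ m : ℕ, ⨆ a : ℕ, ⨆ _ : a ≤ m ∧ (m : ℤ) - 2 * a ≤ c,
        Submodule.map ((N ^ a : Module.End K V) : V →ₗ[K] V)
          (LinearMap.ker M ⊓ Module.End.eigenspace Y (m : K))

/-- Falling factorial of `Y`. -/
def fallD (Y : Module.End K V) : ℕ → Module.End K V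
  | 0 => 1
  | n + 1 => fallD Y n * (Y - (n : K) • 1)

lemma comm_fallD (Y : Module.End K V) (n : ℕ) : Commute Y (fallD Y n) := by
  induction n with
  | zero => exact Commute.one_right _
  | succ n ih =>
    refine ih.mul_right (Commute.sub_right (Commute.refl _) ?_)
    exact (Commute.one_right Y).smul_right _

lemma fallD_eig (Y : Module.End K V) (μ : K) (x : V) (hx : Y x = μ • x) (n : ℕ) :
    fallD Y n x = (∏ i ∈ Finset.range n, (μ - i)) • x := by
  induction n with
  | zero => simp [fallD]
  | succ n ih =>
    have : (Y - (n : K) • 1) x = (μ - n) • x := by simp [hx, sub_smul]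
    rw [fallD, Module.End.mul_apply, this, map_smul, ih, smul_smul, Finset.prod_range_succ, mul_comm]

lemma Y_powN (Y N : Module.End K V) (h2 : ⁅Y, N⁆ = -((2 : K) • N)) (μ : K) (x : V)
    (hx : Y x = μ • x) (n : ℕ) : Y ((N ^ n) x) = (μ - 2 * n) • (N ^ n) x := by
  induction n with
  | zero => simp [hx]
  | succ n ih =>
    have := LinearMap.congr_fun h2 ((N ^ n) x)
    simp only [Ring.lie_def, LinearMap.sub_apply, Module.End.mul_apply, LinearMap.neg_apply,
      LinearMap.smul_apply, ih, map_smul] at this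
    rw [pow_succ', Module.End.mul_apply, sub_eq_iff_eq_add.mp this]
    push_cast
    module

lemma M_powN (M Y N : Module.End K V)
    (h2 : ⁅Y, N⁆ = -((2 : K) • N)) (h3 : ⁅M, N⁆ = Y) (n : ℕ) :
    M * N ^ (n + 1) = N ^ (n + 1) * M + ((n : K) + 1) • (N ^ n * (Y - (n : K) • 1)) := by
  have e3 : M * N = N * M + Y := by rw [← h3, Ring.lie_def]; abel
  have e2 : Y * N = N * Y - (2 : K) • N := by
    have : Y * N - N * Y = -((2 : K) • N) := by rw [← h2, Ring.lie_def]
    rw [sub_eq_iff_eq_add.mp this]; abel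
  induction n with
  | zero => simp [e3]
  | succ n ih =>
    rw [pow_succ N (n + 1), ← mul_assoc, ih, add_mul, mul_assoc, e3, mul_add, smul_mul_assoc,
      mul_assoc, sub_mul, e2]
    simp only [pow_succ, mul_sub, mul_assoc, smul_mul_assoc, one_mul, mul_smul_comm, mul_one]
    push_cast
    module

/-- `M` is nilpotent. -/
lemma M_nilp [FiniteDimensional K V] (M Y : Module.End K V) (h1 : ⁅Y, M⁆ = (2 : K) • M) :
    ∃ r : ℕ, M ^ r = 0 := by
  by_contra! contra
  have key : ∀ n : ℕ, (LinearMap.mulLeft K Y - LinearMap.mulRight K Y) (M ^ n) = (2 * (n : K)) • M ^ n := by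
    intro n
    induction n with
    | zero => simp
    | succ n ih =>
      simp only [LinearMap.sub_apply, LinearMap.mulLeft_apply, LinearMap.mulRight_apply, Ring.lie_def] at ih h1 ⊢
      have : Y * M ^ (n + 1) - M ^ (n + 1) * Y = (Y * M ^ n - M ^ n * Y) * M
          + M ^ n * (Y * M - M * Y) := by rw [pow_succ]; noncomm_ring
      rw [this, ih, h1, pow_succ]
      simp only [smul_mul_assoc, mul_smul_comm]
      push_cast
      module
  have hinj : Function.Injective (fun n : ℕ => 2 * (n : K)) := by
    intro a b h; simpa using h
  have := Module.End.eigenvectors_linearIndependent' (LinearMap.mulLeft K Y - LinearMap.mulRight K Y)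
    (fun n : ℕ => 2 * (n : K)) hinj (fun n => M ^ n)
    (fun n => ⟨Module.End.mem_eigenspace_iff.mpr (key n), contra n⟩)
  have := this.finite
  exact not_finite ℕ

/-- The injectivity of `N ^ l` on weight `l`. -/
lemma inj_pow (M Y N : Module.End K V)
    (h1 : ⁅Y, M⁆ = (2 : K) • M)
    (h2 : ⁅Y, N⁆ = -((2 : K) • N)) (h3 : ⁅M, N⁆ = Y) (s : ℕ) :
    ∀ (l : ℕ) (t : V), Y t = (l : K) • t → (M ^ s) t = 0 → (N ^ l) t = 0 → t = 0 := by
  induction s with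
  | zero => intro l t _ h _; simpa using h
  | succ s ih =>
    intro l t hY hM hN
    have hMt : M t = 0 := by
      refine ih (l + 2) (M t) ?_ (by rwa [pow_succ, Module.End.mul_apply] at hM) ?_
      · have := LinearMap.congr_fun h1 t
        simp only [Ring.lie_def, LinearMap.sub_apply, Module.End.mul_apply,
          LinearMap.smul_apply, hY, map_smul] at this
        rw [sub_eq_iff_eq_add.mp this]
        push_cast
        module
      · have := LinearMap.congr_fun (M_powN M Y N h2 h3 l) t
        simp only [Module.End.mul_apply, LinearMap.add_apply, LinearMap.smul_apply,
          LinearMap.sub_apply, hY, pow_succ' N l, hN, Module.End.one_apply, sub_self,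
          map_zero, smul_zero, add_zero] at this
        rw [pow_succ', pow_succ', Module.End.mul_apply, Module.End.mul_apply, ← this, map_zero]
    have : ∀ n, n ≤ l → (N ^ n) t = 0 → t = 0 := by
      intro n
      induction n with
      | zero => intro _ h; simpa using h
      | succ n ihn =>
        intro hn h
        apply ihn (by omega)
        have e := LinearMap.congr_fun (M_powN M Y N h2 h3 n) t
        simp only [Module.End.mul_apply, h, map_zero, LinearMap.add_apply, hMt, zero_add,
          LinearMap.smul_apply, LinearMap.sub_apply, hY, Module.End.one_apply, ← sub_smul,
          map_smul, smul_smul] at e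
        have c : ((n : K) + 1) * ((l : K) - n) ≠ 0 := by
          refine mul_ne_zero (Nat.cast_add_one_ne_zero n) (sub_ne_zero.mpr ?_)
          exact_mod_cast (by omega : l ≠ n)
        exact (smul_eq_zero.mp e.symm).resolve_left c
    exact this l le_rfl hN

lemma comm_NM (M Y N : Module.End K V)
    (h1 : ⁅Y, M⁆ = (2 : K) • M)
    (h2 : ⁅Y, N⁆ = -((2 : K) • N)) : Commute Y (N * M) := by
  rw [Ring.lie_def] at h1 h2
  have : Y * (N * M) - (N * M) * Y = (Y * N - N * Y) * M + N * (Y * M - M * Y) := by noncomm_ring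
  rw [h1, h2] at this
  refine sub_eq_zero.mp (this.trans ?_)
  simp

lemma pow_pow (M Y N : Module.End K V)
    (h1 : ⁅Y, M⁆ = (2 : K) • M)
    (h2 : ⁅Y, N⁆ = -((2 : K) • N)) (h3 : ⁅M, N⁆ = Y) (n : ℕ) :
    ∀ v : V, N (M v) = 0 → (M ^ n) ((N ^ n) v) = (n.factorial : K) • fallD Y n v := by
  induction n with
  | zero => intro v _; simp [fallD]
  | succ n ih =>
    intro v hv
    have e := LinearMap.congr_fun (M_powN M Y N h2 h3 n) v
    have hv' : N (M ((Y - (n : K) • 1) v)) = 0 := by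
      have := LinearMap.congr_fun (comm_NM M Y N h1 h2).eq v
      simp only [Module.End.mul_apply, hv, map_zero] at this
      simp [hv, ← this]
    rw [pow_succ M, Module.End.mul_apply, ← Module.End.mul_apply M, e]
    simp only [Module.End.mul_apply, LinearMap.add_apply, LinearMap.smul_apply]
    rw [pow_succ N, Module.End.mul_apply, hv, map_zero, zero_add, map_smul, ih _ hv', smul_smul,
      fallD, Module.End.mul_apply, Nat.factorial_succ]
    push_cast
    rfl

lemma split_eig (Y : Module.End K V) (Q : Submodule K V) (hQ : ∀ v ∈ Q, Y v ∈ Q) (n : ℕ) :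
    ∀ v ∈ Q, fallD Y n v = 0 → v ∈ ⨆ i : ℕ, Q ⊓ Module.End.eigenspace Y (i : K) := by
  have hD : ∀ n, ∀ v ∈ Q, fallD Y n v ∈ Q := by
    intro n
    induction n with
    | zero => intro v hv; simpa [fallD] using hv
    | succ n ih =>
      intro v hv
      rw [fallD, Module.End.mul_apply]
      apply ih
      simpa using Q.sub_mem (hQ v hv) (Q.smul_mem _ hv)
  induction n with
  | zero => intro v _ h; simp [fallD] at h; simp [h]
  | succ n ih =>
    intro v hv h
    have hw : Y (fallD Y n v) = (n : K) • fallD Y n v := by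
      have := LinearMap.congr_fun (comm_fallD Y n).eq v
      simp only [Module.End.mul_apply] at this
      rw [fallD, Module.End.mul_apply] at h
      simp only [LinearMap.sub_apply, LinearMap.smul_apply, Module.End.one_apply, map_sub,
        map_smul] at h
      rw [this]; exact sub_eq_zero.mp h
    set c : K := ∏ i ∈ Finset.range n, ((n : K) - i) with hc
    have c0 : c ≠ 0 := by
      rw [hc, Finset.prod_ne_zero_iff]
      intro i hi
      rw [Finset.mem_range] at hi
      refine sub_ne_zero.mpr ?_
      exact_mod_cast (by omega : n ≠ i)
    have hwQ := Q.smul_mem c⁻¹ (hD n v hv)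
    have a1 := ih (v - c⁻¹ • fallD Y n v) (Q.sub_mem hv hwQ) (by
      rw [map_sub, map_smul, fallD_eig Y n (fallD Y n v) hw n, ← hc, smul_smul,
        inv_mul_cancel₀ c0, one_smul, sub_self])
    have a2 : c⁻¹ • fallD Y n v ∈ ⨆ i : ℕ, Q ⊓ Module.End.eigenspace Y (i : K) := by
      refine Submodule.mem_iSup_of_mem n ⟨hwQ, Submodule.smul_mem _ _ ?_⟩
      exact Module.End.mem_eigenspace_iff.mpr hw
    simpa using Submodule.add_mem _ a1 a2

lemma ker_NM [FiniteDimensional K V] (M Y N : Module.End K V) (k : ℕ) (hnil : N ^ (k + 1) = 0)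
    (h1 : ⁅Y, M⁆ = (2 : K) • M)
    (h2 : ⁅Y, N⁆ = -((2 : K) • N)) (h3 : ⁅M, N⁆ = Y) (v : V) (hv : N (M v) = 0) :
    v ∈ ⨆ i : ℕ, LinearMap.ker M ⊓ Module.End.eigenspace Y (i : K) := by
  obtain ⟨r, hr⟩ := M_nilp M Y h1
  have h0 : fallD Y (k + 1) v = 0 := by
    have := pow_pow M Y N h1 h2 h3 (k + 1) v hv
    rw [hnil, LinearMap.zero_apply, map_zero] at this
    exact (smul_eq_zero.mp this.symm).resolve_left (by exact_mod_cast Nat.factorial_ne_zero _)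
  have := split_eig Y (LinearMap.ker (N * M)) (by
    intro x hx
    have e := LinearMap.congr_fun (comm_NM M Y N h1 h2).eq x
    rw [LinearMap.mem_ker] at hx ⊢
    rw [Module.End.mul_apply, hx, map_zero] at e
    rw [← Module.End.mul_apply, ← e]) (k + 1) v hv h0
  refine SetLike.le_def.mp (iSup_mono ?_) this
  rintro i x ⟨hx, hx'⟩
  refine ⟨?_, hx'⟩
  rw [SetLike.mem_coe, Module.End.mem_eigenspace_iff] at hx'
  have hx : N (M x) = 0 := hx
  refine inj_pow M Y N h1 h2 h3 r (i + 2) (M x) ?_ (by simp [hr]) ?_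
  · have := LinearMap.congr_fun h1 x
    simp only [Ring.lie_def, LinearMap.sub_apply, Module.End.mul_apply,
      LinearMap.smul_apply, hx', map_smul] at this
    rw [sub_eq_iff_eq_add.mp this]
    push_cast
    module
  · rw [pow_succ, Module.End.mul_apply, hx, map_zero]

lemma mem_strS (M Y N : Module.End K V) (c : ℤ) (m a : ℕ) (ha : a ≤ m)
    (hc : (m : ℤ) - 2 * a ≤ c) (p : V) (hM : M p = 0) (hY : Y p = (m : K) • p) :
    (N ^ a) p ∈ strS M Y N c := by
  refine Submodule.mem_iSup_of_mem m (Submodule.mem_iSup_of_mem a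
    (Submodule.mem_iSup_of_mem ⟨ha, hc⟩ ⟨p, ⟨hM, ?_⟩, rfl⟩))
  exact Module.End.mem_eigenspace_iff.mpr hY

lemma strS_le (M Y N : Module.End K V) (c : ℤ) (T : Submodule K V)
    (h : ∀ (m a : ℕ) (p : V), a ≤ m → (m : ℤ) - 2 * a ≤ c → M p = 0 → Y p = (m : K) • p →
      (N ^ a) p ∈ T) : strS M Y N c ≤ T := by
  refine iSup_le fun m => iSup_le fun a => iSup_le fun hh => ?_
  rintro _ ⟨p, ⟨hM, hY⟩, rfl⟩
  exact h m a p hh.1 hh.2 hM (Module.End.mem_eigenspace_iff.mp hY)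

lemma prim_zero [FiniteDimensional K V] (M Y N : Module.End K V) (k : ℕ) (hnil : N ^ (k + 1) = 0)
    (h1 : ⁅Y, M⁆ = (2 : K) • M)
    (h2 : ⁅Y, N⁆ = -((2 : K) • N)) (h3 : ⁅M, N⁆ = Y) (m : ℕ) (hm : k < m) (p : V)
    (hY : Y p = (m : K) • p) : p = 0 := by
  obtain ⟨r, hr⟩ := M_nilp M Y h1
  refine inj_pow M Y N h1 h2 h3 r m p hY (by simp [hr]) ?_
  obtain ⟨d, rfl⟩ : ∃ d, m = d + (k + 1) := ⟨m - (k + 1), by omega⟩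
  simp [pow_add N d, hnil]

lemma prim_pow [FiniteDimensional K V] (M Y N : Module.End K V) (k : ℕ) (hnil : N ^ (k + 1) = 0)
    (h1 : ⁅Y, M⁆ = (2 : K) • M)
    (h2 : ⁅Y, N⁆ = -((2 : K) • N)) (h3 : ⁅M, N⁆ = Y) (m : ℕ) (p : V) (hM : M p = 0)
    (hY : Y p = (m : K) • p) : (N ^ (m + 1)) p = 0 := by
  have e := LinearMap.congr_fun (M_powN M Y N h2 h3 m) p
  simp only [Module.End.mul_apply, LinearMap.add_apply, hM, map_zero, zero_add,
      LinearMap.smul_apply, LinearMap.sub_apply, hY, Module.End.one_apply, ← sub_smul,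
      map_smul, smul_smul, sub_self, smul_zero] at e
  set x := (N ^ (m + 1)) p with hx
  have hYx : Y x = ((m : K) - 2 * ((m + 1 : ℕ) : K)) • x := Y_powN Y N h2 _ p hY (m + 1)
  have := pow_pow M Y N h1 h2 h3 (k + 1) x (by rw [e, map_zero])
  rw [hnil, LinearMap.zero_apply, map_zero, fallD_eig Y _ x hYx, smul_smul] at this
  refine (smul_eq_zero.mp this.symm).resolve_left (mul_ne_zero
    (by exact_mod_cast Nat.factorial_ne_zero _) ?_)
  rw [Finset.prod_ne_zero_iff]
  intro i _ h
  have h' : ((m + 2 + i : ℕ) : K) = 0 := by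
    push_cast at h ⊢
    linear_combination -h
  have := Nat.cast_eq_zero.mp h'
  omega

lemma strS_top [FiniteDimensional K V] (M Y N : Module.End K V) (k : ℕ) (hnil : N ^ (k + 1) = 0)
    (h1 : ⁅Y, M⁆ = (2 : K) • M)
    (h2 : ⁅Y, N⁆ = -((2 : K) • N)) (h3 : ⁅M, N⁆ = Y) (c : ℤ) (hc : k ≤ c) :
    strS M Y N c = ⊤ := by
  have kerle : ∀ v, N (M v) = 0 → v ∈ strS M Y N c := by
    intro v hv
    refine SetLike.le_def.mp (iSup_le ?_) (ker_NM M Y N k hnil h1 h2 h3 v hv)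
    rintro i x ⟨hx, hx'⟩
    have hx' := Module.End.mem_eigenspace_iff.mp hx'
    by_cases hi : k < i
    · rw [prim_zero M Y N k hnil h1 h2 h3 i hi x hx']; exact zero_mem _
    · simpa using mem_strS M Y N c i 0 (by omega) (by push_cast; omega) x hx hx'
  have step : ∀ v, v ∈ strS M Y N c → N v ∈ (strS M Y N c).map (N * M) := by
    intro v hv
    have : strS M Y N c ≤ ((strS M Y N c).map (N * M)).comap N := by
      apply strS_le
      intro m a p ha hma hM hY
      rw [Submodule.mem_comap]
      have e := LinearMap.congr_fun (M_powN M Y N h2 h3 a) p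
      simp only [Module.End.mul_apply, LinearMap.add_apply, hM, map_zero, zero_add,
          LinearMap.smul_apply, LinearMap.sub_apply, hY, Module.End.one_apply, ← sub_smul,
          map_smul, smul_smul] at e
      by_cases ham : a = m
      · have hz : N ((N ^ a) p) = 0 := by
          rw [← Module.End.mul_apply, ← pow_succ', ham]
          exact prim_pow M Y N k hnil h1 h2 h3 m p hM hY
        rw [hz]; exact zero_mem _
      · have c0 : ((a : K) + 1) * ((m : K) - a) ≠ 0 := by
          refine mul_ne_zero (Nat.cast_add_one_ne_zero a) (sub_ne_zero.mpr ?_)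
          exact_mod_cast (Ne.symm ham)
        refine ⟨(((a : K) + 1) * ((m : K) - a))⁻¹ • (N ^ (a + 1)) p, ?_, ?_⟩
        · exact Submodule.smul_mem _ _ (mem_strS M Y N c m (a + 1) (by omega)
            (by push_cast; omega) p hM hY)
        · rw [map_smul, Module.End.mul_apply, e, map_smul, smul_smul, inv_mul_cancel₀ c0, one_smul]
    exact this hv
  obtain ⟨r, hr⟩ := M_nilp M Y h1
  have all : ∀ s v, (M ^ s) v = 0 → v ∈ strS M Y N c := by
    intro s
    induction s with
    | zero => intro v h; have : v = 0 := by simpa using h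
              rw [this]; exact zero_mem _
    | succ s ih =>
      intro v h
      rw [pow_succ, Module.End.mul_apply] at h
      obtain ⟨t, ht, hte⟩ := step _ (ih _ h)
      have := kerle (v - t) (by
        rw [map_sub, map_sub, ← hte, Module.End.mul_apply, sub_self])
      simpa using Submodule.add_mem _ this ht
  exact eq_top_iff.mpr fun v _ => all r v (by simp [hr])

lemma strS_N [FiniteDimensional K V] (M Y N : Module.End K V) (k : ℕ) (hnil : N ^ (k + 1) = 0)
    (h1 : ⁅Y, M⁆ = (2 : K) • M)
    (h2 : ⁅Y, N⁆ = -((2 : K) • N)) (h3 : ⁅M, N⁆ = Y) (n : ℕ) : ∀ (c : ℤ) (v : V),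
    v ∈ strS M Y N c → (N ^ n) v ∈ strS M Y N (c - 2 * n) := by
  induction n with
  | zero => intro c v hv; simpa using hv
  | succ n ih =>
    intro c v hv
    rw [pow_succ, Module.End.mul_apply]
    have : strS M Y N c ≤ (strS M Y N (c - 2)).comap N := by
      apply strS_le
      intro m a p ha hma hM hY
      rw [Submodule.mem_comap, ← Module.End.mul_apply, ← pow_succ']
      by_cases ham : a = m
      · rw [ham, prim_pow M Y N k hnil h1 h2 h3 m p hM hY]; exact zero_mem _
      · exact mem_strS M Y N _ m (a + 1) (by omega) (by push_cast; omega) p hM hY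
    have := ih _ _ (this hv)
    convert this using 2
    push_cast; ring

lemma strS_mono (M Y N : Module.End K V) {c d : ℤ} (h : c ≤ d) :
    strS M Y N c ≤ strS M Y N d :=
  strS_le _ _ _ _ _ fun m a p ha hma hM hY => mem_strS M Y N d m a ha (hma.trans h) p hM hY

lemma strS_inj [FiniteDimensional K V] (M Y N : Module.End K V)
    (h1 : ⁅Y, M⁆ = (2 : K) • M)
    (h2 : ⁅Y, N⁆ = -((2 : K) • N)) (h3 : ⁅M, N⁆ = Y)
    (hNS : ∀ (n : ℕ) (c : ℤ) (v : V),
      v ∈ strS M Y N c → (N ^ n) v ∈ strS M Y N (c - 2 * n)) (l : ℕ) (u : V)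
    (hu : u ∈ strS M Y N l) (hNu : (N ^ l) u ∈ strS M Y N (-l - 1)) :
    u ∈ strS M Y N (l - 1) := by
  obtain ⟨r, hr⟩ := M_nilp M Y h1
  have wt : ∀ (m a : ℕ) (p : V), Y p = (m : K) • p →
      (N ^ a) p ∈ Module.End.eigenspace Y (((m : ℤ) - 2 * a : ℤ) : K) := by
    intro m a p hY
    rw [Module.End.mem_eigenspace_iff, Y_powN Y N h2 _ p hY]
    push_cast; rfl
  have d1 : strS M Y N l ≤ strS M Y N (l - 1) ⊔ Module.End.eigenspace Y (l : K) := by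
    apply strS_le
    intro m a p ha hma hM hY
    by_cases h : (m : ℤ) - 2 * a ≤ l - 1
    · exact Submodule.mem_sup_left (mem_strS M Y N _ m a ha h p hM hY)
    · refine Submodule.mem_sup_right ?_
      have := wt m a p hY
      rw [show (m : ℤ) - 2 * a = l by omega] at this
      exact_mod_cast this
  have d2 : strS M Y N (-l - 1) ≤
      ⨆ j, ⨆ _ : j ≠ (-(l : K)), Module.End.eigenspace Y j := by
    apply strS_le
    intro m a p ha hma hM hY
    refine Submodule.mem_iSup_of_mem _ (Submodule.mem_iSup_of_mem ?_ (wt m a p hY))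
    have : (m : ℤ) - 2 * a ≠ -(l : ℤ) := by omega
    exact_mod_cast this
  obtain ⟨u', hu', t, ht, rfl⟩ := Submodule.mem_sup.mp (d1 hu)
  have hYt := Module.End.mem_eigenspace_iff.mp ht
  have e1 : (N ^ l) t ∈ strS M Y N (-l - 1) := by
    have a := hNS l _ u' hu'
    rw [show (l : ℤ) - 1 - 2 * l = -l - 1 by ring] at a
    have := Submodule.sub_mem _ hNu a
    simpa using this
  have e2 : (N ^ l) t ∈ Module.End.eigenspace Y (-(l : K)) := by
    rw [Module.End.mem_eigenspace_iff, Y_powN Y N h2 _ t hYt]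
    congr 1; ring
  have e3 : (N ^ l) t = 0 :=
    Submodule.disjoint_def.mp ((Module.End.eigenspaces_iSupIndep Y) (-(l : K))) _ e2 (d2 e1)
  rw [inj_pow M Y N h1 h2 h3 r l t hYt (by simp [hr]) e3, add_zero]
  exact hu'

end SlTwoAux

open SlTwoAux in
theorem weight_filtration_eq_sum_of_strings
    (K : Type*) [Field K] [CharZero K]
    (V : Type*) [AddCommGroup V] [Module K V] [FiniteDimensional K V]
    (k : ℕ) (M Y N : Module.End K V) (hnil : N ^ (k + 1) = 0)
    (h1 : ⁅Y, M⁆ = (2 : K) • M)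
    (h2 : ⁅Y, N⁆ = -((2 : K) • N))
    (h3 : ⁅M, N⁆ = Y)
    (W : ℤ → Submodule K V) (hW : IsWeightFiltration K V k N W) :
    ∀ ℓ : ℤ, W ℓ =
      ⨆ m : ℕ, ⨆ a : ℕ, ⨆ _ : a ≤ m ∧ (m : ℤ) - 2 * a ≤ ℓ - k,
        Submodule.map ((N ^ a : Module.End K V) : V →ₗ[K] V)
          (LinearMap.ker M ⊓ Module.End.eigenspace Y (m : K)) := by
  intro ℓ
  change W ℓ = strS M Y N (ℓ - k)
  obtain ⟨hmono, hbot, htop, hN, hgr⟩ := hW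
  have hNS := strS_N M Y N k hnil h1 h2 h3
  have hNW : ∀ (n : ℕ) (c : ℤ) (v : V), v ∈ W c → (N ^ n) v ∈ W (c - 2 * n) := by
    intro n
    induction n with
    | zero => intro c v hv; simpa using hv
    | succ n ih =>
      intro c v hv
      rw [pow_succ, Module.End.mul_apply]
      have := ih _ _ (hN c ⟨v, hv, rfl⟩)
      convert this using 2
      push_cast; ring
  have hker : ∀ (d m : ℕ) (p : V), k ≤ m + d → (N ^ (m + 1)) p = 0 → p ∈ W (k + m) := by
    intro d
    induction d with
    | zero => intro m p hk _; rw [htop _ (by omega)]; trivial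
    | succ d ih =>
      intro m p hk hp
      by_cases hkm : k ≤ m
      · rw [htop _ (by omega)]; trivial
      have a := ih (m + 1) p (by omega) (by
        rw [pow_succ', Module.End.mul_apply, hp, map_zero])
      have b := (hgr (m + 1) (by omega)).2 p a (by rw [hp]; exact zero_mem _)
      convert b using 2
      push_cast; ring
  have le1 : ∀ c : ℤ, strS M Y N c ≤ W (k + c) := by
    intro c
    apply strS_le
    intro m a p ha hma hM hY
    have := hker k m p (by omega) (prim_pow M Y N k hnil h1 h2 h3 m p hM hY)
    exact hmono (by omega) (hNW a _ _ this)
  have low : ∀ j : ℕ, (∀ i : ℕ, j ≤ i → W (k + i) ≤ strS M Y N i) →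
      ∀ (d i : ℕ), j ≤ i → k < i + d → W (k - i) ≤ strS M Y N (-i) := by
    intro j hj d
    induction d with
    | zero => intro i _ hi; rw [hbot _ (by omega)]; exact bot_le
    | succ d ih =>
      intro i hji hi v hv
      by_cases hik : i ≤ k
      · obtain ⟨u, hu, huv⟩ := (hgr i hik).1 v hv
        have a := hNS i _ u (hj i hji hu)
        rw [show (i : ℤ) - 2 * i = -i by ring] at a
        have b : v - (N ^ i) u ∈ strS M Y N (-((i + 1 : ℕ) : ℤ)) := by
          refine ih (i + 1) (by omega) (by omega) ?_
          convert huv using 2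
          push_cast; ring
        have b' := strS_mono M Y N (d := -(i : ℤ)) (by push_cast; omega) b
        simpa using Submodule.add_mem _ b' a
      · rw [hbot _ (by omega)] at hv
        rw [(Submodule.mem_bot K).mp hv]; exact zero_mem _
  have up : ∀ d j : ℕ, k ≤ j + d → ∀ i : ℕ, j ≤ i → W (k + i) ≤ strS M Y N i := by
    intro d
    induction d with
    | zero =>
      intro j hj i hi
      rw [strS_top M Y N k hnil h1 h2 h3 i (by omega)]; exact le_top
    | succ d ih =>
      intro j hj i hi v hv
      have IH := ih (j + 1) (by omega)
      by_cases hij : j + 1 ≤ i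
      · exact IH i hij hv
      obtain rfl : i = j := by omega
      have a : v ∈ strS M Y N ((i + 1 : ℕ) : ℤ) :=
        IH (i + 1) le_rfl (hmono (by push_cast; omega) hv)
      have b : (N ^ (i + 1)) v ∈ strS M Y N (-((i + 2 : ℕ) : ℤ)) := by
        refine low (i + 1) IH (k + 1) (i + 2) (by omega) (by omega) ?_
        have := hNW (i + 1) _ _ hv
        convert this using 2
        push_cast; ring
      have := strS_inj M Y N h1 h2 h3 hNS (i + 1) v a
        (strS_mono M Y N (by push_cast; omega) b)
      simpa using this
  have up0 := up k 0 (by omega)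
  apply le_antisymm
  · rcases le_total (k : ℤ) ℓ with h | h
    · obtain ⟨i, hi⟩ := Int.eq_ofNat_of_zero_le (sub_nonneg.mpr h)
      have := up0 i (by omega)
      rw [hi, show ℓ = k + i by omega]; exact this
    · obtain ⟨i, hi⟩ := Int.eq_ofNat_of_zero_le (sub_nonneg.mpr h)
      have := low 0 up0 (k + 1) i (by omega) (by omega)
      rw [show ℓ - k = -(i : ℤ) by omega, show ℓ = k - i by omega]; exact this
  · have := le1 (ℓ - k)
    rwa [show (k : ℤ) + (ℓ - k) = ℓ by ring] at this
end

section
/- Let Q be a nondegenerate symmetric or skew-symmetric bilinear form on a finite-dimensional vector space V and let G = Aut(V,Q). If N, N' ∈ End(V,Q) are nilpotent and conjugate under GL(V) ... then over ℂ with Q symmetric or skew, N and N' having equal Jordan type (equal multiplicities m_ℓ for all ℓ) implies N' = g N g^{-1} for some g ∈ Aut(V_ℂ, Q). -/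
open Polynomial in
/-- Square roots of `X` modulo products of linear factors with nonzero roots. -/
lemma gc_sqrt_mod (s : Multiset ℂ) (hs : (0 : ℂ) ∉ s) :
    ∃ q r : ℂ[X], q ^ 2 - X = (s.map fun a => X - C a).prod * r := by
  induction s using Multiset.induction_on with
  | empty => exact ⟨0, -X, by simp⟩
  | cons a s ih =>
    obtain ⟨q, r, h⟩ := ih (fun h => hs (Multiset.mem_cons_of_mem h))
    have ha : a ≠ 0 := fun h => hs (by simp [h])
    set P := (s.map fun a => X - C a).prod with hP
    have key : ∃ c : ℂ, r.eval a + 2 * q.eval a * c + P.eval a * c ^ 2 = 0 := by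
      by_cases hPa : P.eval a = 0
      · have h1 := congrArg (Polynomial.eval a) h
        simp [hPa] at h1
        have hq : q.eval a ≠ 0 := by
          intro h0
          rw [h0] at h1
          apply ha
          simpa using h1
        refine ⟨-(r.eval a) / (2 * q.eval a), ?_⟩
        rw [hPa]
        field_simp
        ring
      · obtain ⟨d, hd⟩ := IsAlgClosed.exists_pow_nat_eq
          ((q.eval a) ^ 2 - P.eval a * r.eval a) (n := 2) (by norm_num)
        refine ⟨(-(q.eval a) + d) / P.eval a, ?_⟩
        field_simp
        linear_combination hd
    obtain ⟨c, hc⟩ := key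
    have hdvd : X - C a ∣ r + 2 * q * C c + P * C c ^ 2 := by
      rw [Polynomial.dvd_iff_isRoot]
      simpa [Polynomial.IsRoot] using hc
    obtain ⟨t, ht⟩ := hdvd
    refine ⟨q + P * C c, t, ?_⟩
    rw [Multiset.map_cons, Multiset.prod_cons, ← hP]
    linear_combination h + P * ht

open Polynomial in
lemma gc_sqrt {V : Type*} [AddCommGroup V] [Module ℂ V] [FiniteDimensional ℂ V]
    (A : Module.End ℂ V) (hA : Function.Injective A) :
    ∃ q : ℂ[X], (aeval A q) ^ 2 = A := by
  have hm : (minpoly ℂ A).Monic := minpoly.monic (Algebra.IsIntegral.isIntegral A)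
  have h0 : (0 : ℂ) ∉ (minpoly ℂ A).roots := by
    intro h
    have h1 := (Polynomial.mem_roots'.1 h).2
    have h2 := Module.End.hasEigenvalue_of_isRoot h1
    obtain ⟨v, hv⟩ := h2.exists_hasEigenvector
    have := hv.apply_eq_smul
    rw [zero_smul] at this
    exact hv.2 (hA (by simpa using this))
  obtain ⟨q, r, h⟩ := gc_sqrt_mod _ h0
  refine ⟨q, ?_⟩
  have hs := (IsAlgClosed.splits (minpoly ℂ A)).eq_prod_roots_of_monic hm
  rw [← hs] at h
  have := congrArg (aeval A) h
  simp only [map_sub, map_pow, aeval_X, map_mul, minpoly.aeval, zero_mul] at this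
  exact sub_eq_zero.1 this

lemma gc_finrank_comap {V W : Type*} [AddCommGroup V] [Module ℂ V] [FiniteDimensional ℂ V]
    [AddCommGroup W] [Module ℂ W] [FiniteDimensional ℂ W]
    (f : V →ₗ[ℂ] W) (hf : Function.Surjective f) (p : Submodule ℂ W) :
    Module.finrank ℂ (p.comap f) = Module.finrank ℂ (LinearMap.ker f) + Module.finrank ℂ p := by
  have h1 := LinearMap.finrank_range_add_finrank_ker f
  have h2 := LinearMap.finrank_range_add_finrank_ker (p.mkQ ∘ₗ f)
  have h3 := p.finrank_quotient_add_finrank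
  rw [LinearMap.range_eq_top.2 hf, finrank_top] at h1
  rw [LinearMap.range_eq_top.2 (by
    rw [LinearMap.coe_comp]; exact (Submodule.mkQ_surjective p).comp hf), finrank_top,
    LinearMap.ker_comp, Submodule.ker_mkQ] at h2
  omega

/-- The restriction of an endomorphism to its range. -/
noncomputable def gcRes {V : Type*} [AddCommGroup V] [Module ℂ V] (N : Module.End ℂ V) :
    Module.End ℂ (LinearMap.range N) :=
  N.restrict (p := LinearMap.range N) (q := LinearMap.range N) (fun x _ => ⟨x, rfl⟩)

lemma gcRes_coe {V : Type*} [AddCommGroup V] [Module ℂ V] (N : Module.End ℂ V)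
    (x : LinearMap.range N) : ((gcRes N x : LinearMap.range N) : V) = N x := rfl

lemma gcRes_pow_coe {V : Type*} [AddCommGroup V] [Module ℂ V] (N : Module.End ℂ V) (j : ℕ)
    (x : LinearMap.range N) : (((gcRes N ^ j) x : LinearMap.range N) : V) = (N ^ j) x := by
  induction j with
  | zero => simp
  | succ j ih => rw [pow_succ', pow_succ', Module.End.mul_apply, Module.End.mul_apply,
      gcRes_coe, ih]

lemma gcRes_finrank {V : Type*} [AddCommGroup V] [Module ℂ V] [FiniteDimensional ℂ V]
    (N : Module.End ℂ V) (j : ℕ) :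
    Module.finrank ℂ (LinearMap.ker (N ^ (j + 1))) =
      Module.finrank ℂ (LinearMap.ker N) + Module.finrank ℂ (LinearMap.ker (gcRes N ^ j)) := by
  have := gc_finrank_comap N.rangeRestrict N.surjective_rangeRestrict
    (LinearMap.ker (gcRes N ^ j))
  rw [LinearMap.ker_rangeRestrict] at this
  rw [← this]
  have : LinearMap.ker (N ^ (j + 1)) =
      (LinearMap.ker (gcRes N ^ j)).comap N.rangeRestrict := by
    ext x
    rw [Submodule.mem_comap, LinearMap.mem_ker, LinearMap.mem_ker, ← Subtype.coe_inj,
      gcRes_pow_coe, pow_succ, Module.End.mul_apply]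
    rfl
  rw [this]

lemma gc_compl {V : Type*} [AddCommGroup V] [Module ℂ V] [FiniteDimensional ℂ V]
    (N : Module.End ℂ V) :
    ∃ K T : Submodule ℂ V, K ≤ LinearMap.ker N ∧ K ≤ T ∧ IsCompl (LinearMap.range N) T ∧
      (∀ v ∈ LinearMap.ker N, ∃ r ∈ LinearMap.range N, ∃ k ∈ K, r + k = v) ∧
      Module.finrank ℂ K + Module.finrank ℂ (LinearMap.ker (gcRes N)) =
        Module.finrank ℂ (LinearMap.ker N) := by
  obtain ⟨K, hK⟩ := exists_isCompl ((LinearMap.range N).comap (LinearMap.ker N).subtype)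
  have hle : K.map (LinearMap.ker N).subtype ≤ LinearMap.ker N := Submodule.map_subtype_le _ _
  have hdisj : Disjoint (LinearMap.range N) (K.map (LinearMap.ker N).subtype) := by
    rw [Submodule.disjoint_def]
    rintro x hx ⟨y, hy, rfl⟩
    have := (Submodule.disjoint_def.1 hK.disjoint) y hx hy
    simp [this]
  obtain ⟨T, hT, hTc⟩ := hdisj.symm.exists_isCompl
  refine ⟨_, T, hle, ?_, ?_, ?_, ?_⟩
  · exact hT
  · exact hTc.symm
  · intro v hv
    obtain ⟨r, hr, k, hk, h⟩ := Submodule.mem_sup.1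
      (show (⟨v, hv⟩ : LinearMap.ker N) ∈ _ ⊔ K by rw [hK.sup_eq_top]; trivial)
    exact ⟨r, hr, k, ⟨k, hk, rfl⟩, congrArg Subtype.val h⟩
  · have h1 := Submodule.finrank_add_eq_of_isCompl hK
    have h2 : Module.finrank ℂ (K.map (LinearMap.ker N).subtype) = Module.finrank ℂ K :=
      (LinearEquiv.finrank_eq (Submodule.equivMapOfInjective
        (LinearMap.ker N).subtype (Submodule.subtype_injective _) K)).symm
    have h3 : Module.finrank ℂ ((LinearMap.range N).comap (LinearMap.ker N).subtype) =
        Module.finrank ℂ (LinearMap.ker (gcRes N)) := by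
      have e1 := LinearEquiv.finrank_eq (Submodule.equivMapOfInjective
        (LinearMap.ker N).subtype (Submodule.subtype_injective _)
        ((LinearMap.range N).comap (LinearMap.ker N).subtype))
      have e2 := LinearEquiv.finrank_eq (Submodule.equivMapOfInjective
        (LinearMap.range N).subtype (Submodule.subtype_injective _)
        (LinearMap.ker (gcRes N)))
      rw [e1, e2]
      have : ((LinearMap.range N).comap (LinearMap.ker N).subtype).map
          (LinearMap.ker N).subtype = (LinearMap.ker (gcRes N)).map
          (LinearMap.range N).subtype := by
        ext x
        constructor
        · rintro ⟨y, hy, rfl⟩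
          exact ⟨⟨y, hy⟩, Subtype.ext y.2, rfl⟩
        · rintro ⟨y, hy, rfl⟩
          exact ⟨⟨y, congrArg Subtype.val (show gcRes N y = 0 from hy)⟩, y.2, rfl⟩
      rw [this]
    omega

universe u in
/-- Nilpotents with equal kernel dimensions are linearly conjugate. -/
lemma gc_conj (n : ℕ) : ∀ (V W : Type u) [AddCommGroup V] [Module ℂ V] [FiniteDimensional ℂ V]
    [AddCommGroup W] [Module ℂ W] [FiniteDimensional ℂ W]
    (N : Module.End ℂ V) (N' : Module.End ℂ W), N ^ n = 0 → N' ^ n = 0 →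
    (∀ j : ℕ, Module.finrank ℂ (LinearMap.ker (N ^ j)) =
        Module.finrank ℂ (LinearMap.ker (N' ^ j))) →
    ∃ g : V ≃ₗ[ℂ] W, ∀ v, g (N v) = N' (g v) := by
  induction n with
  | zero =>
    intro V W _ _ _ _ _ _ N N' h h' hj
    have hV : ∀ v : V, v = 0 := fun v => by simpa using LinearMap.congr_fun h v
    have hW : ∀ v : W, v = 0 := fun v => by simpa using LinearMap.congr_fun h' v
    exact ⟨⟨0, fun _ => 0, fun v => (hV v).symm, fun v => (hW v).symm⟩,
      fun v => by rw [hW (N' _)]; exact hW _⟩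
  | succ n ih =>
    intro V W _ _ _ _ _ _ N N' h h' hj
    have res0 : ∀ {U : Type u} [AddCommGroup U] [Module ℂ U] (M : Module.End ℂ U),
        M ^ (n + 1) = 0 → gcRes M ^ n = 0 := by
      intro U _ _ M hM
      ext ⟨x, y, rfl⟩
      rw [gcRes_pow_coe]
      have := LinearMap.congr_fun hM y
      rwa [pow_succ, Module.End.mul_apply] at this
    have hdim : Module.finrank ℂ V = Module.finrank ℂ W := by
      have := hj (n + 1)
      rwa [h, h', LinearMap.ker_zero, LinearMap.ker_zero, finrank_top, finrank_top] at this
    have hj1 : Module.finrank ℂ (LinearMap.ker N) = Module.finrank ℂ (LinearMap.ker N') := by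
      have := hj 1
      rwa [pow_one, pow_one] at this
    have hjr : ∀ j, Module.finrank ℂ (LinearMap.ker (gcRes N ^ j)) =
        Module.finrank ℂ (LinearMap.ker (gcRes N' ^ j)) := by
      intro j
      have h1 := gcRes_finrank N j
      have h2 := gcRes_finrank N' j
      have := hj (j + 1)
      omega
    obtain ⟨φ, hφ⟩ := ih _ _ (gcRes N) (gcRes N') (res0 N h) (res0 N' h') hjr
    obtain ⟨K, T, hK, hKT, hT, hdec, hfr⟩ := gc_compl N
    obtain ⟨K', T', hK', hKT', hT', -, hfr'⟩ := gc_compl N'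
    have hKK : Module.finrank ℂ K = Module.finrank ℂ K' := by
      have := hjr 1
      rw [pow_one, pow_one] at this
      omega
    let κ : K ≃ₗ[ℂ] K' := LinearEquiv.ofFinrankEq K K' hKK
    obtain ⟨δ, hδ⟩ := LinearMap.exists_extend (Submodule.inclusion hK' ∘ₗ κ.toLinearMap)
    obtain ⟨s, hs⟩ := LinearMap.exists_rightInverse_of_surjective N'.rangeRestrict
      (LinearMap.range_eq_top.2 N'.surjective_rangeRestrict)
    have hs' : ∀ y : LinearMap.range N', N' (s y) = y := fun y =>
      congrArg Subtype.val (LinearMap.congr_fun hs y)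
    let f0 : V →ₗ[ℂ] W := s ∘ₗ φ.toLinearMap ∘ₗ N.rangeRestrict + (LinearMap.ker N').subtype ∘ₗ δ
    let ψ : V →ₗ[ℂ] W := LinearMap.ofIsCompl hT
      ((LinearMap.range N').subtype ∘ₗ φ.toLinearMap) (f0 ∘ₗ T.subtype)
    have hψr : ∀ x : LinearMap.range N, ψ x = φ x := fun x => by
      simp [ψ]
    have hψT : ∀ x : T, ψ x = f0 x := fun x => by
      simp [ψ]
    have hf0 : ∀ v, N' (f0 v) = φ (N.rangeRestrict v) := by
      intro v
      have hd : N' (δ v : W) = 0 := (δ v).2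
      simp [f0, hs', hd]
    have hψN : ∀ v, N' (ψ v) = φ (N.rangeRestrict v) := by
      intro v
      obtain ⟨r, hr, t, ht, rfl⟩ := Submodule.mem_sup.1
        (show v ∈ LinearMap.range N ⊔ T by rw [hT.sup_eq_top]; trivial)
      have e1 := hψr ⟨r, hr⟩
      have e2 := hψT ⟨t, ht⟩
      simp only at e1 e2
      rw [map_add, map_add, map_add, map_add, Submodule.coe_add, e1, e2, hf0]
      congr 1
      exact (congrArg Subtype.val (hφ ⟨r, hr⟩)).symm
    have hψK : ∀ k : K, ψ k = κ k := by
      intro k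
      have e := hψT ⟨k, hKT k.2⟩
      simp only at e
      rw [e]
      have hk0 : N.rangeRestrict (k : V) = 0 := Subtype.ext (hK k.2)
      have e2 : δ k = Submodule.inclusion hK' (κ k) := LinearMap.congr_fun hδ k
      simp [f0, hk0, e2]
    have hinj : Function.Injective ψ := by
      rw [injective_iff_map_eq_zero]
      intro v hv
      have h1 := hψN v
      rw [hv, map_zero] at h1
      have h2 : N.rangeRestrict v = 0 := φ.injective (by
        rw [map_zero]; exact Subtype.ext h1.symm)
      have h3 : v ∈ LinearMap.ker N := congrArg Subtype.val h2
      obtain ⟨r, hr, k, hk, rfl⟩ := hdec v h3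
      have e1 := hψr ⟨r, hr⟩
      have e2 := hψK ⟨k, hk⟩
      simp only at e1 e2
      rw [map_add, e1, e2] at hv
      have h4 : ((φ ⟨r, hr⟩ : LinearMap.range N') : W) = 0 := by
        refine Submodule.disjoint_def.1 hT'.disjoint _ (φ ⟨r, hr⟩).2 ?_
        rw [eq_neg_of_add_eq_zero_left hv]
        exact T'.neg_mem (hKT' (κ ⟨k, hk⟩).2)
      rw [h4, zero_add] at hv
      have hr0 : (⟨r, hr⟩ : LinearMap.range N) = 0 := φ.injective (by
        rw [map_zero]; exact Subtype.ext h4)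
      have hk0 : (⟨k, hk⟩ : K) = 0 := κ.injective (by
        rw [map_zero]; exact Subtype.ext hv)
      have hr1 : r = 0 := congrArg Subtype.val hr0
      have hk1 : k = 0 := congrArg Subtype.val hk0
      rw [hr1, hk1, add_zero]
    refine ⟨LinearEquiv.ofInjectiveOfFinrankEq ψ hinj hdim, fun v => ?_⟩
    have e1 := hψr (N.rangeRestrict v)
    have : ψ (N v) = N' (ψ v) := by rw [hψN]; exact e1
    exact this

lemma gc_comm {V : Type*} [AddCommGroup V] [Module ℂ V] (A N : Module.End ℂ V)
    (h : Commute A N) (p : Polynomial ℂ) : Commute (Polynomial.aeval A p) N := by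
  induction p using Polynomial.induction_on' with
  | add a b ha hb => rw [map_add]; exact ha.add_left hb
  | monomial i c =>
    rw [Polynomial.aeval_monomial]
    exact Commute.mul_left (Algebra.commutes c N) (h.pow_left i)

lemma gc_adj {V : Type*} [AddCommGroup V] [Module ℂ V] (Q : V →ₗ[ℂ] V →ₗ[ℂ] ℂ)
    (A : Module.End ℂ V) (h : ∀ u v, Q (A u) v = Q u (A v)) (p : Polynomial ℂ) :
    ∀ u v, Q (Polynomial.aeval A p u) v = Q u (Polynomial.aeval A p v) := by
  have hpow : ∀ (i : ℕ) (u v : V), Q ((A ^ i) u) v = Q u ((A ^ i) v) := by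
    intro i
    induction i with
    | zero => intro u v; simp
    | succ i ih =>
      intro u v
      rw [pow_succ, Module.End.mul_apply, ih, h, ← Module.End.mul_apply, ← pow_succ', pow_succ]
  induction p using Polynomial.induction_on' with
  | add a b ha hb => intro u v; simp [ha, hb]
  | monomial i c => intro u v; simp [Polynomial.aeval_monomial, hpow]

/-- **Gerstenhaber's theorem.**
Let `Q` be a nondegenerate `(-1)^k`-symmetric bilinear form on a finite-dimensional
complex vector space `V`.  If `N, N' ∈ End(V,Q)` are nilpotent with equal Jordan type
(equivalently `dim ker (N^j) = dim ker (N'^j)` for all `j`, i.e. equal multiplicities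
`m_ℓ`), then `N' = g N g⁻¹` for some `g ∈ Aut(V,Q)`. -/
theorem gerstenhaber_conjugacy
    (V : Type*) [AddCommGroup V] [Module ℂ V] [FiniteDimensional ℂ V]
    (k : ℕ) (Q : V →ₗ[ℂ] V →ₗ[ℂ] ℂ)
    (hnondeg : ∀ u : V, (∀ v : V, Q u v = 0) → u = 0)
    (hsymm : ∀ u v : V, Q u v = (-1 : ℂ) ^ k * Q v u)
    (N N' : Module.End ℂ V)
    (hNskew : ∀ u v : V, Q (N u) v = -Q u (N v))
    (hN'skew : ∀ u v : V, Q (N' u) v = -Q u (N' v))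
    (hNnil : IsNilpotent N) (hN'nil : IsNilpotent N')
    (hjordan : ∀ j : ℕ, Module.finrank ℂ (LinearMap.ker (N ^ j)) =
        Module.finrank ℂ (LinearMap.ker (N' ^ j))) :
    ∃ g : V ≃ₗ[ℂ] V, (∀ u v : V, Q (g u) (g v) = Q u v) ∧
      N' = (LinearEquiv.conj g) N := by
  obtain ⟨n, hn⟩ := hNnil
  obtain ⟨m, hm⟩ := hN'nil
  obtain ⟨h, hh⟩ := gc_conj (n + m) V V N N' (by rw [pow_add, hn, zero_mul])
    (by rw [pow_add, hm, mul_zero]) hjordan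
  have hQinj : Function.Injective Q := by
    rw [injective_iff_map_eq_zero]
    intro u hu
    exact hnondeg u (fun v => by rw [hu]; rfl)
  let q : V ≃ₗ[ℂ] Module.Dual ℂ V :=
    LinearEquiv.ofInjectiveOfFinrankEq Q hQinj Subspace.dual_finrank_eq.symm
  have hq : ∀ u, q u = Q u := fun u => rfl
  have ext' : ∀ u u' : V, (∀ v, Q u v = Q u' v) → u = u' := fun u u' e =>
    hQinj (LinearMap.ext e)
  let A : Module.End ℂ V := q.symm.toLinearMap ∘ₗ (Q.compl₁₂ h.toLinearMap h.toLinearMap)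
  have hA : ∀ u v, Q (A u) v = Q (h u) (h v) := by
    intro u v
    rw [← hq]
    simp [A]
  have hAinj : Function.Injective A := by
    rw [injective_iff_map_eq_zero]
    intro u hu
    have : h u = 0 := hnondeg _ (fun v => by
      have := hA u (h.symm v)
      rw [hu] at this
      simpa using this.symm)
    simpa using this
  have hAN : Commute A N := by
    refine LinearMap.ext fun u => ext' _ _ fun v => ?_
    rw [Module.End.mul_apply, Module.End.mul_apply, hA, hh, hN'skew, hNskew, hA, hh]
  have hAs : ∀ u v, Q (A u) v = Q u (A v) := by
    intro u v
    rw [hA, hsymm, ← hA, hsymm u]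
  obtain ⟨p, hp⟩ := gc_sqrt A hAinj
  set B := Polynomial.aeval A p with hB
  have hBN : Commute B N := by
    rw [hB]
    exact gc_comm A N hAN p
  have hBs : ∀ u v, Q (B u) v = Q u (B v) := gc_adj Q A hAs p
  have hBinj : Function.Injective B := by
    rw [← hp] at hAinj
    rw [pow_two] at hAinj
    exact Function.Injective.of_comp (f := B) hAinj
  let b : V ≃ₗ[ℂ] V := LinearEquiv.ofInjectiveEndo B hBinj
  have hb : ∀ u, B (b.symm u) = u := fun u => b.apply_symm_apply u
  have hbh : ∀ u v, Q (h u) (h v) = Q (B u) (B v) := by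
    intro u v
    rw [← hA, ← hp, pow_two, Module.End.mul_apply, hBs]
  refine ⟨b.symm.trans h, fun u v => ?_, ?_⟩
  · simp only [LinearEquiv.trans_apply]
    rw [hbh, hb, hb]
  · refine LinearMap.ext fun v => ?_
    have hc : ∀ v, B (N v) = N (B v) := fun v => LinearMap.congr_fun hBN v
    have : b.symm (N (B (h.symm v))) = N (h.symm v) := by
      rw [← hc]; exact b.symm_apply_apply _
    have e : (LinearEquiv.conj (b.symm.trans h)) N v = h (b.symm (N (B (h.symm v)))) := rfl
    rw [e, this, hh, h.apply_symm_apply]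
end
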